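/- arXiv:2106.06878 — 2 statements merged into one kernel-verified Lean document; each statement's English description precedes it below -/
import Mathlib

section
/- Fix constants λ > 0 and ε > 0. For each n, let k = ⌈λn/log n⌉, let K be a fixed subset of the n items of size k, let T = ⌈(1+ε)·(λ/(log 2)²)·n⌉, and form a random test design in which each of the n items independently draws L = ⌈T·(log 2)/k⌉ tests uniformly at random with replacement from the T tests. Then the probability that every item i ∉ K has at least one drawn test that was drawn by no item of K (i.e., the probability that the COMP decoder exactly recovers K) tends to 1 as n → ∞. -/
open Filter Finset

section Counting

variable {ι κ τ : Type*} [Fintype ι] [DecidableEq ι] [Fintype κ]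
  [Fintype τ] [DecidableEq τ]

/-- The tests that no item of `K` draws in the configuration `d`. -/
def negativeTests (K : Finset ι) (d : ι → κ → τ) : Finset τ :=
  univ.filter fun t => ∀ j ∈ K, ∀ l, d j l ≠ t

lemma negativeTests_update {K : Finset ι} {i : ι} (hi : i ∉ K) (d : ι → κ → τ) (a : κ → τ) :
    negativeTests K (Function.update d i a) = negativeTests K d := by
  ext t
  simp only [negativeTests, mem_filter, mem_univ, true_and]
  refine forall₂_congr fun j hj => ?_
  have hji : j ≠ i := by
    rintro rfl
    exact hi hj
  rw [Function.update_of_ne hji]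

variable [DecidableEq κ]

lemma card_filter_subset_negativeTests (K : Finset ι) (S : Finset τ) :
    #{d : ι → κ → τ | S ⊆ negativeTests K d} =
      ((Fintype.card τ - #S) ^ Fintype.card κ) ^ #K *
        (Fintype.card τ ^ Fintype.card κ) ^ (Fintype.card ι - #K) := by
  have h : ({d : ι → κ → τ | S ⊆ negativeTests K d} : Finset _) =
      Fintype.piFinset fun j => if j ∈ K then Fintype.piFinset (fun _ => Sᶜ) else univ := by
    ext d
    simp only [mem_filter, mem_univ, true_and, Fintype.mem_piFinset, negativeTests,
      subset_iff]
    constructor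
    · intro h j
      split_ifs with hj
      · simp only [Fintype.mem_piFinset, mem_compl]
        exact fun l hl => h hl j hj l rfl
      · exact mem_univ _
    · intro h t ht j hj l hl
      have := h j
      simp only [hj, if_true, Fintype.mem_piFinset, mem_compl] at this
      exact this l (hl ▸ ht)
  rw [h, Fintype.card_piFinset, ← prod_mul_prod_compl K]
  congr 1
  · rw [prod_congr rfl (g := fun _ => (Fintype.card τ - #S) ^ Fintype.card κ), prod_const]
    intro j hj
    simp [hj, card_compl]
  · rw [prod_congr rfl (g := fun _ => Fintype.card τ ^ Fintype.card κ), prod_const, card_compl]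
    intro j hj
    simp [mem_compl.1 hj]

lemma card_filter_subset_negativeTests_eq [Nonempty τ] (K : Finset ι) (S : Finset τ) :
    (#{d : ι → κ → τ | S ⊆ negativeTests K d} : ℝ) =
      (Fintype.card τ : ℝ) ^ (Fintype.card ι * Fintype.card κ) *
        (1 - #S / Fintype.card τ) ^ (#K * Fintype.card κ) := by
  have hT : (Fintype.card τ : ℝ) ≠ 0 := by exact_mod_cast Fintype.card_ne_zero
  rw [card_filter_subset_negativeTests]
  push_cast [card_le_univ S]
  have h1 : (Fintype.card τ : ℝ) - #S = Fintype.card τ * (1 - #S / Fintype.card τ) := by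
    field_simp
  rw [h1, ← pow_mul, ← pow_mul, mul_pow, mul_comm #K, mul_right_comm, ← pow_add, ← mul_add,
    Nat.add_sub_cancel' (card_le_univ K), mul_comm (Fintype.card κ)]

lemma sum_card_negativeTests [Nonempty τ] (K : Finset ι) :
    ∑ d : ι → κ → τ, (#(negativeTests K d) : ℝ) =
      (Fintype.card τ : ℝ) ^ (Fintype.card ι * Fintype.card κ) *
        (Fintype.card τ * (1 - 1 / Fintype.card τ) ^ (#K * Fintype.card κ)) := by
  have h (d : ι → κ → τ) :
      (#(negativeTests K d) : ℝ) = ∑ t, if {t} ⊆ negativeTests K d then 1 else 0 := by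
    simp
  simp_rw [h]
  rw [sum_comm]
  simp_rw [sum_boole, card_filter_subset_negativeTests_eq]
  simp
  ring

lemma sum_card_negativeTests_sq_le [Nonempty τ] (K : Finset ι) (hτ : 2 ≤ Fintype.card τ) :
    ∑ d : ι → κ → τ, (#(negativeTests K d) : ℝ) ^ 2 ≤
      (Fintype.card τ : ℝ) ^ (Fintype.card ι * Fintype.card κ) *
        (Fintype.card τ +
          (Fintype.card τ * (1 - 1 / Fintype.card τ) ^ (#K * Fintype.card κ)) ^ 2) := by
  have hT : (2 : ℝ) ≤ Fintype.card τ := by exact_mod_cast hτ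
  have h (d : ι → κ → τ) : (#(negativeTests K d) : ℝ) ^ 2 =
      ∑ t, ∑ t', if {t, t'} ⊆ negativeTests K d then 1 else 0 := by
    have h1 : (#(negativeTests K d) : ℝ) = ∑ t, if t ∈ negativeTests K d then 1 else 0 := by
      simp
    rw [sq, h1, sum_mul_sum]
    refine sum_congr rfl fun t _ => sum_congr rfl fun t' _ => ?_
    by_cases ht : t ∈ negativeTests K d <;> by_cases ht' : t' ∈ negativeTests K d <;>
      simp [insert_subset_iff, ht, ht']
  simp_rw [h]
  rw [sum_comm]
  simp_rw [sum_comm (s := (univ : Finset (ι → κ → τ)))]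
  simp_rw [sum_boole, card_filter_subset_negativeTests_eq, ← mul_sum]
  refine mul_le_mul_of_nonneg_left ?_ (by positivity)
  set M := #K * Fintype.card κ
  set T : ℝ := (Fintype.card τ : ℝ) with hTdef
  have hinv : 1 / T ≤ 1 / 2 := one_div_le_one_div_of_le (by norm_num) hT
  have hinv0 : 0 ≤ 1 / T := by positivity
  calc ∑ t : τ, ∑ t' : τ, (1 - (#{t, t'} : ℝ) / T) ^ M
      ≤ ∑ t : τ, ∑ t' : τ, ((if t = t' then 1 else 0) + ((1 - 1 / T) ^ M) ^ 2) := by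
        refine sum_le_sum fun t _ => sum_le_sum fun t' _ => ?_
        by_cases htt : t = t'
        · subst htt
          have : (1 - 1 / T) ^ M ≤ 1 := pow_le_one₀ (by linarith) (by linarith)
          simp only [pair_eq_singleton, card_singleton, Nat.cast_one, if_true]
          linarith [sq_nonneg ((1 - 1 / T) ^ M)]
        · rw [card_pair htt, if_neg htt, zero_add, pow_right_comm (1 - 1 / T)]
          have h2 : ((2 : ℕ) : ℝ) / T = 2 * (1 / T) := by push_cast; ring
          rw [h2]
          exact pow_le_pow_left₀ (by linarith) (by nlinarith) _
    _ = T + (T * (1 - 1 / T) ^ M) ^ 2 := by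
        simp [sum_add_distrib, ← hTdef]
        ring

/-- Chebyshev's inequality for the number of negative tests. -/
lemma card_filter_card_negativeTests_lt_le [Nonempty τ] (K : Finset ι)
    (hτ : 2 ≤ Fintype.card τ) {δ : ℝ} (hδ : 0 < δ) :
    (#{d : ι → κ → τ | (#(negativeTests K d) : ℝ) <
        ((1 - 1 / Fintype.card τ) ^ (#K * Fintype.card κ) - δ) * Fintype.card τ} : ℝ) ≤
      (Fintype.card τ : ℝ) ^ (Fintype.card ι * Fintype.card κ) *
        (1 / (δ ^ 2 * Fintype.card τ)) := by
  have hsum := sum_card_negativeTests (κ := κ) (τ := τ) K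
  have hsq := sum_card_negativeTests_sq_le (κ := κ) (τ := τ) K hτ
  set T : ℝ := (Fintype.card τ : ℝ) with hTdef
  have hT : (0 : ℝ) < T := by rw [hTdef]; exact_mod_cast Fintype.card_pos
  set q := (1 - 1 / T) ^ (#K * Fintype.card κ)
  set Z := T ^ (Fintype.card ι * Fintype.card κ) with hZ
  have hcard : (Fintype.card (ι → κ → τ) : ℝ) = Z := by
    simp [hZ, hTdef, ← pow_mul, mul_comm]
  have hvar : ∑ d : ι → κ → τ, ((#(negativeTests K d) : ℝ) - T * q) ^ 2 ≤ Z * T := by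
    have : ∑ d : ι → κ → τ, ((#(negativeTests K d) : ℝ) - T * q) ^ 2 =
        ∑ d : ι → κ → τ, (#(negativeTests K d) : ℝ) ^ 2 -
          2 * (T * q) * ∑ d : ι → κ → τ, (#(negativeTests K d) : ℝ) + Z * (T * q) ^ 2 := by
      have hconst : Z * (T * q) ^ 2 = ∑ _d : ι → κ → τ, (T * q) ^ 2 := by
        rw [sum_const, card_univ, nsmul_eq_mul, hcard]
      rw [hconst, mul_sum, ← sum_sub_distrib, ← sum_add_distrib]
      exact sum_congr rfl fun d _ => by ring
    rw [this, hsum]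
    nlinarith
  have hmarkov : (#{d : ι → κ → τ | (#(negativeTests K d) : ℝ) < (q - δ) * T} : ℝ) *
      (δ * T) ^ 2 ≤ Z * T := by
    refine le_trans ?_ hvar
    rw [← nsmul_eq_mul, ← sum_const]
    refine le_trans (sum_le_sum fun d hd => ?_)
      (sum_le_sum_of_subset_of_nonneg (filter_subset _ univ) fun _ _ _ => sq_nonneg _)
    have hd' := (mem_filter.1 hd).2
    have : 0 < δ * T := by positivity
    nlinarith
  rw [mul_one_div, le_div_iff₀ (by positivity)]
  refine le_of_mul_le_mul_right ?_ hT
  linarith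

lemma sum_sum_update {ι α : Type*} [Fintype ι] [DecidableEq ι] [Fintype α] (i : ι)
    (f : (ι → α) → ℝ) :
    ∑ d : ι → α, ∑ a, f (Function.update d i a) = Fintype.card α * ∑ d, f d := by
  have hinv : Function.Involutive
      fun p : (ι → α) × α => (Function.update p.1 i p.2, p.1 i) := by
    rintro ⟨d, a⟩
    simp
  rw [← Fintype.sum_prod_type' (fun d a => f (Function.update d i a)),
    ← Equiv.sum_comp hinv.toPerm, Fintype.sum_prod_type]
  simp [Function.Involutive.toPerm, mul_sum]

lemma card_filter_forall_notMem_negativeTests_le [Nonempty τ] {K : Finset ι} {i : ι}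
    (hi : i ∉ K) (c : ℝ) (hc : c ≤ 1) :
    (#{d : ι → κ → τ | c * Fintype.card τ ≤ #(negativeTests K d) ∧
        ∀ l, d i l ∉ negativeTests K d} : ℝ) ≤
      (Fintype.card τ : ℝ) ^ (Fintype.card ι * Fintype.card κ) *
        (1 - c) ^ Fintype.card κ := by
  have hT : (0 : ℝ) < Fintype.card τ := by exact_mod_cast Fintype.card_pos
  rw [← sum_boole]
  have h := sum_sum_update i fun d : ι → κ → τ =>
    if c * Fintype.card τ ≤ #(negativeTests K d) ∧ ∀ l, d i l ∉ negativeTests K d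
      then (1 : ℝ) else 0
  have hcard : (Fintype.card (κ → τ) : ℝ) = (Fintype.card τ : ℝ) ^ Fintype.card κ := by simp
  rw [hcard] at h
  refine le_of_mul_le_mul_left (h.symm.trans_le ?_) (pow_pos hT (Fintype.card κ))
  have key (d : ι → κ → τ) :
      ∑ a : κ → τ, (if c * Fintype.card τ ≤ #(negativeTests K (Function.update d i a)) ∧
        ∀ l, Function.update d i a i l ∉ negativeTests K (Function.update d i a)
        then (1 : ℝ) else 0) ≤
      (Fintype.card τ : ℝ) ^ Fintype.card κ * (1 - c) ^ Fintype.card κ := by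
    simp only [negativeTests_update hi, Function.update_self]
    by_cases hN : c * Fintype.card τ ≤ #(negativeTests K d)
    · have hset : ({a : κ → τ | ∀ l, a l ∉ negativeTests K d} : Finset _) =
          Fintype.piFinset fun _ => (negativeTests K d)ᶜ := by
        ext a; simp
      simp only [hN, true_and, sum_boole, hset, Fintype.card_piFinset, prod_const, card_univ,
        card_compl]
      push_cast [card_le_univ (negativeTests K d)]
      rw [← mul_pow]
      refine pow_le_pow_left₀ (sub_nonneg.2 (by exact_mod_cast card_le_univ _)) (by linarith) _
    · simp only [hN, false_and, if_false, sum_const_zero]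
      have : 0 ≤ 1 - c := by linarith
      positivity
  refine (sum_le_sum fun d _ => key d).trans (le_of_eq ?_)
  simp only [sum_const, card_univ, nsmul_eq_mul, Fintype.card_fun, Nat.cast_pow]
  rw [← pow_mul, mul_comm (Fintype.card κ)]
  ring

/-- Chebyshev and union bound for the failure probability of COMP. -/
lemma one_sub_le_comp_success [Nonempty τ] (K : Finset ι) (hτ : 2 ≤ Fintype.card τ)
    {δ : ℝ} (hδ : 0 < δ) :
    1 - (1 / (δ ^ 2 * Fintype.card τ) + Fintype.card ι *
        (1 - ((1 - 1 / Fintype.card τ) ^ (#K * Fintype.card κ) - δ)) ^ Fintype.card κ) ≤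
      (Nat.card {d : ι → κ → τ //
        ∀ i ∉ K, ∃ l, ∀ j ∈ K, ∀ l', d j l' ≠ d i l} : ℝ) /
        (Fintype.card τ : ℝ) ^ (Fintype.card ι * Fintype.card κ) := by
  have hT : (1 : ℝ) ≤ Fintype.card τ := by exact_mod_cast Fintype.card_pos
  have hcheb := card_filter_card_negativeTests_lt_le (κ := κ) K hτ hδ
  set q : ℝ := (1 - 1 / Fintype.card τ) ^ (#K * Fintype.card κ) with hq
  have hq1 : q - δ ≤ 1 := by
    have : q ≤ 1 := pow_le_one₀ (by rw [sub_nonneg, div_le_one (by linarith)]; exact hT)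
      (by linarith [show (0 : ℝ) ≤ 1 / Fintype.card τ by positivity])
    linarith
  have hmiss (i : ι) (hi : i ∈ Kᶜ) :=
    card_filter_forall_notMem_negativeTests_le (κ := κ) (τ := τ) (mem_compl.1 hi) (q - δ) hq1
  set Z : ℝ := (Fintype.card τ : ℝ) ^ (Fintype.card ι * Fintype.card κ) with hZ
  have hZpos : 0 < Z := by positivity
  have hcard : (#(univ : Finset (ι → κ → τ)) : ℝ) = Z := by
    simp [hZ, ← pow_mul, mul_comm]
  have hcover : (univ : Finset (ι → κ → τ)) ⊆
      ({d | ∀ i ∉ K, ∃ l, ∀ j ∈ K, ∀ l', d j l' ≠ d i l} : Finset _) ∪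
      (({d | (#(negativeTests K d) : ℝ) < (q - δ) * Fintype.card τ} : Finset _) ∪
        Kᶜ.biUnion fun i => ({d | (q - δ) * Fintype.card τ ≤ #(negativeTests K d) ∧
          ∀ l, d i l ∉ negativeTests K d} : Finset _)) := by
    intro d _
    by_contra hd
    simp only [mem_union, mem_filter, mem_univ, true_and, mem_biUnion, mem_compl, not_or,
      not_lt] at hd
    obtain ⟨h1, h2, h3⟩ := hd
    refine h1 fun i hi => ?_
    by_contra hl
    refine h3 ⟨i, hi, h2, fun l hmem => hl ⟨l, ?_⟩⟩
    exact (mem_filter.1 hmem).2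
  have hle : Z ≤ (#{d : ι → κ → τ | ∀ i ∉ K, ∃ l, ∀ j ∈ K, ∀ l', d j l' ≠ d i l} : ℝ) +
      (Z * (1 / (δ ^ 2 * Fintype.card τ)) +
        Fintype.card ι * (Z * (1 - (q - δ)) ^ Fintype.card κ)) := by
    rw [← hcard]
    refine (Nat.cast_le.2 ((card_le_card hcover).trans ((card_union_le _ _).trans
      (Nat.add_le_add_left ((card_union_le _ _).trans
        (Nat.add_le_add_left card_biUnion_le _)) _)))).trans ?_
    rw [hcard]
    push_cast
    gcongr
    refine (sum_le_card_nsmul _ _ _ hmiss).trans ?_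
    rw [nsmul_eq_mul]
    have : 0 ≤ 1 - (q - δ) := by linarith
    gcongr
    exact card_le_univ _
  rw [Nat.card_eq_fintype_card, Fintype.card_subtype, le_div_iff₀ hZpos]
  linarith

end Counting

section Asymptotics

lemma tendsto_log_natCast_div_natCast :
    Tendsto (fun n : ℕ => Real.log n / n) atTop (nhds 0) :=
  Real.isLittleO_log_id_atTop.tendsto_div_nhds_zero.comp tendsto_natCast_atTop_atTop

lemma tendsto_ceil_div_log_div {lam : ℝ} (hlam : 0 < lam) :
    Tendsto (fun n : ℕ => (⌈lam * n / Real.log n⌉₊ : ℝ) / n) atTop (nhds 0) := by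
  have hlog : Tendsto (fun n : ℕ => Real.log n) atTop atTop :=
    Real.tendsto_log_atTop.comp tendsto_natCast_atTop_atTop
  have hub : Tendsto (fun n : ℕ => lam / Real.log n + 1 / n) atTop (nhds 0) := by
    simpa using (hlog.const_div_atTop lam).add tendsto_one_div_atTop_nhds_zero_nat
  refine squeeze_zero' (Eventually.of_forall fun n => by positivity) ?_ hub
  filter_upwards [eventually_ge_atTop 1] with n hn
  have hn0 : (1 : ℝ) ≤ n := by exact_mod_cast hn
  have hl : 0 ≤ Real.log n := Real.log_nonneg hn0
  rw [div_le_iff₀ (by linarith)]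
  have := (Nat.ceil_lt_add_one (a := lam * n / Real.log n) (by positivity)).le
  refine this.trans (le_of_eq ?_)
  field_simp

lemma exp_neg_div_le_one_sub_inv_pow {T : ℝ} (hT : 1 < T) (M : ℕ) :
    Real.exp (-(M / (T - 1))) ≤ (1 - 1 / T) ^ M := by
  have h : Real.exp (-(1 / (T - 1))) ≤ 1 - 1 / T := by
    have hT1 : 0 < T - 1 := by linarith
    have h1 : 1 - 1 / T = (1 / (T - 1) + 1)⁻¹ := by
      field_simp
      ring
    rw [h1, Real.exp_neg]
    exact inv_anti₀ (by positivity) (Real.add_one_le_exp _)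
  calc Real.exp (-(M / (T - 1))) = Real.exp (-(1 / (T - 1))) ^ M := by
        rw [← Real.exp_nat_mul]
        congr 1
        ring
    _ ≤ _ := pow_le_pow_left₀ (Real.exp_pos _).le h M

/-- If `k / T → 0` and `T → ∞`, a given test is negative with probability at least
`1 / 2 - o(1)`. -/
lemma eventually_le_one_sub_inv_pow {k T : ℕ → ℕ} (hk : ∀ᶠ n in atTop, 0 < k n)
    (hT : Tendsto (fun n => (T n : ℝ)) atTop atTop)
    (hkT : Tendsto (fun n => (k n : ℝ) / T n) atTop (nhds 0)) {a : ℝ} (ha : a < 1 / 2) :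
    ∀ᶠ n in atTop,
      a ≤ (1 - 1 / (T n : ℝ)) ^ (k n * ⌈(T n : ℝ) * Real.log 2 / (k n : ℝ)⌉₊) := by
  have hlim : Tendsto
      (fun n => Real.exp (-((Real.log 2 + (k n : ℝ) / T n) / (1 - 1 / (T n : ℝ)))))
      atTop (nhds (1 / 2)) := by
    have h := ((tendsto_const_nhds (x := Real.log 2)).add hkT).div
      ((tendsto_const_nhds (x := (1 : ℝ))).sub (hT.const_div_atTop 1)) (by norm_num)
    have h2 := (Real.continuous_exp.tendsto _).comp h.neg
    have hhalf : Real.exp (-((Real.log 2 + 0) / (1 - 0))) = 1 / 2 := by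
      simp [Real.exp_neg, Real.exp_log]
    rwa [hhalf] at h2
  filter_upwards [hlim.eventually_const_lt ha, hk, hT.eventually_gt_atTop 1] with n hn hkn hTn
  refine hn.le.trans ((Real.exp_le_exp.2 (neg_le_neg ?_)).trans
    (exp_neg_div_le_one_sub_inv_pow hTn _))
  have hk0 : (0 : ℝ) < k n := by exact_mod_cast hkn
  have hT1 : 0 < (T n : ℝ) - 1 := by linarith
  have hl2 : 0 < Real.log 2 := Real.log_pos (by norm_num)
  have hrhs : (Real.log 2 + (k n : ℝ) / T n) / (1 - 1 / (T n : ℝ)) =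
      (T n * Real.log 2 + k n) / (T n - 1) := by
    have : (T n : ℝ) ≠ 0 := by linarith
    have h3 : 1 - 1 / (T n : ℝ) = (T n - 1) / T n := by field_simp
    rw [h3]
    field_simp
  rw [hrhs]
  refine div_le_div_of_nonneg_right ?_ hT1.le
  have hL := (Nat.ceil_lt_add_one (a := (T n : ℝ) * Real.log 2 / k n) (by positivity)).le
  push_cast
  calc (k n : ℝ) * ⌈(T n : ℝ) * Real.log 2 / k n⌉₊
      ≤ k n * ((T n : ℝ) * Real.log 2 / k n + 1) := by gcongr
    _ = _ := by field_simp

lemma eventually_log_le_ceil_mul_log_two {lam ε : ℝ} (hlam : 0 < lam) (hε : 0 < ε) :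
    ∀ᶠ n : ℕ in atTop, (1 + ε / 2) * Real.log n ≤
      (⌈(⌈(1 + ε) * (lam / (Real.log 2) ^ 2) * n⌉₊ : ℝ) * Real.log 2 /
        (⌈lam * n / Real.log n⌉₊ : ℝ)⌉₊ : ℝ) * Real.log 2 := by
  have hsmall : 0 < ε / 2 * lam / (1 + ε / 2) := by positivity
  filter_upwards [tendsto_log_natCast_div_natCast.eventually_lt_const hsmall,
    eventually_ge_atTop 2] with n hn hn2
  have hn0 : (2 : ℝ) ≤ n := by exact_mod_cast hn2
  have hlog : 0 < Real.log n := Real.log_pos (by linarith)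
  have hl2 : 0 < Real.log 2 := Real.log_pos (by norm_num)
  have hT := Nat.le_ceil ((1 + ε) * (lam / (Real.log 2) ^ 2) * n)
  have hk := (Nat.ceil_lt_add_one (a := lam * n / Real.log n) (by positivity)).le
  have hkpos : (0 : ℝ) < ⌈lam * n / Real.log n⌉₊ :=
    lt_of_lt_of_le (by positivity) (Nat.le_ceil _)
  set k : ℝ := (⌈lam * n / Real.log n⌉₊ : ℝ)
  set T : ℝ := (⌈(1 + ε) * (lam / (Real.log 2) ^ 2) * n⌉₊ : ℝ)
  refine le_trans ?_ (mul_le_mul_of_nonneg_right (Nat.le_ceil _) hl2.le)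
  rw [div_mul_eq_mul_div, le_div_iff₀ hkpos]
  have h1 : (1 + ε) * lam * n ≤ T * Real.log 2 * Real.log 2 := by
    calc (1 + ε) * lam * n =
        (1 + ε) * (lam / (Real.log 2) ^ 2) * n * Real.log 2 * Real.log 2 := by field_simp
      _ ≤ _ := by gcongr
  have h2 : k * Real.log n ≤ lam * n + Real.log n := by
    calc k * Real.log n ≤ (lam * n / Real.log n + 1) * Real.log n := by gcongr
      _ = _ := by field_simp
  have h3 : (1 + ε / 2) * Real.log n ≤ ε / 2 * lam * n := by
    rw [div_lt_div_iff₀ (by linarith) (by positivity)] at hn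
    linarith
  refine le_trans ?_ h1
  nlinarith

end Asymptotics

/-- Upper bound via near-constant tests-per-item designs: with `k = ⌈λn/log n⌉` defectives
`K`, `T = ⌈(1+ε)·(λ/(log 2)²)·n⌉` tests, and each of the `n` items drawing
`L = ⌈T·log 2 / k⌉` tests uniformly with replacement (a configuration being a uniformly
random `d : Fin n → Fin L → Fin T`), the probability that every item `i ∉ K` has some drawn
test that was drawn by no item of `K` (i.e. that COMP exactly recovers `K`) tends to `1`. -/
theorem comp_success_probability_tendsto_one (lam ε : ℝ) (hlam : 0 < lam) (hε : 0 < ε)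
    (K : ∀ n : ℕ, Finset (Fin n))
    (hK : ∀ᶠ n : ℕ in atTop, (K n).card = ⌈lam * n / Real.log n⌉₊) :
    Tendsto (fun n : ℕ =>
        let k : ℕ := ⌈lam * n / Real.log n⌉₊
        let T : ℕ := ⌈(1 + ε) * (lam / (Real.log 2) ^ 2) * n⌉₊
        let L : ℕ := ⌈(T : ℝ) * Real.log 2 / (k : ℝ)⌉₊
        (Nat.card {d : Fin n → Fin L → Fin T //
            ∀ i ∉ K n, ∃ l : Fin L, ∀ j ∈ K n, ∀ l' : Fin L, d j l' ≠ d i l} : ℝ)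
          / (T : ℝ) ^ (n * L))
      atTop (nhds 1) := by
  have hl2 : 0 < Real.log 2 := Real.log_pos (by norm_num)
  have hA : 0 < (1 + ε) * (lam / (Real.log 2) ^ 2) := by positivity
  have hTtop : Tendsto (fun n : ℕ => (⌈(1 + ε) * (lam / (Real.log 2) ^ 2) * n⌉₊ : ℝ))
      atTop atTop :=
    tendsto_atTop_mono (fun n => Nat.le_ceil _)
      (tendsto_natCast_atTop_atTop.const_mul_atTop hA)
  have hkT : Tendsto (fun n : ℕ => (⌈lam * n / Real.log n⌉₊ : ℝ) /
      (⌈(1 + ε) * (lam / (Real.log 2) ^ 2) * n⌉₊ : ℝ)) atTop (nhds 0) := by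
    have hub := (tendsto_ceil_div_log_div hlam).div_const ((1 + ε) * (lam / (Real.log 2) ^ 2))
    rw [zero_div] at hub
    refine squeeze_zero' (Eventually.of_forall fun n => by positivity) ?_ hub
    filter_upwards [eventually_ge_atTop 1] with n hn
    have hn0 : (0 : ℝ) < n := by exact_mod_cast hn
    rw [div_div, mul_comm (n : ℝ)]
    exact div_le_div_of_nonneg_left (by positivity) (by positivity) (Nat.le_ceil _)
  have hkpos : ∀ᶠ n : ℕ in atTop, 0 < ⌈lam * n / Real.log n⌉₊ := by
    filter_upwards [eventually_ge_atTop 2] with n hn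
    have hn0 : (2 : ℝ) ≤ n := by exact_mod_cast hn
    have hlog : 0 < Real.log n := Real.log_pos (by linarith)
    exact Nat.ceil_pos.2 (by positivity)
  obtain ⟨r, hr⟩ : ∃ r, r = Real.exp (-(Real.log 2 / (1 + ε / 4))) := ⟨_, rfl⟩
  have hr2 : 1 / 2 < r := by
    have h : (1 : ℝ) / 2 = Real.exp (-Real.log 2) := by
      simp [Real.exp_neg, Real.exp_log]
    rw [hr, h, Real.exp_lt_exp, neg_lt_neg_iff]
    exact div_lt_self hl2 (by linarith)
  obtain ⟨δ, hδ⟩ : ∃ δ, δ = (r - 1 / 2) / 2 := ⟨_, rfl⟩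
  have hδpos : 0 < δ := by linarith
  obtain ⟨γ, hγ⟩ : ∃ γ, γ = ε / 4 / (1 + ε / 4) := ⟨_, rfl⟩
  have hγpos : 0 < γ := hγ ▸ by positivity
  have hlow : Tendsto (fun n : ℕ =>
      1 - (1 / (δ ^ 2 * (⌈(1 + ε) * (lam / (Real.log 2) ^ 2) * n⌉₊ : ℝ)) +
        Real.exp (-(γ * Real.log n)))) atTop (nhds 1) := by
    have h1 := (hTtop.const_mul_atTop (pow_pos hδpos 2)).const_div_atTop 1
    have h2 : Tendsto (fun n : ℕ => Real.exp (-(γ * Real.log n))) atTop (nhds 0) :=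
      Real.tendsto_exp_neg_atTop_nhds_zero.comp
        ((Real.tendsto_log_atTop.comp tendsto_natCast_atTop_atTop).const_mul_atTop hγpos)
    simpa using (h1.add h2).const_sub 1
  refine tendsto_of_tendsto_of_tendsto_of_le_of_le' hlow tendsto_const_nhds ?_ ?_
  · filter_upwards [hK, hTtop.eventually_ge_atTop 2, eventually_ge_atTop 1,
      eventually_log_le_ceil_mul_log_two hlam hε,
      eventually_le_one_sub_inv_pow (a := 1 / 2 - δ) hkpos hTtop hkT (by linarith)]
      with n hKn hTn hn hL hq
    dsimp only
    set k : ℕ := ⌈lam * n / Real.log n⌉₊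
    set T : ℕ := ⌈(1 + ε) * (lam / (Real.log 2) ^ 2) * n⌉₊
    set L : ℕ := ⌈(T : ℝ) * Real.log 2 / (k : ℝ)⌉₊
    have hT2 : 2 ≤ T := by exact_mod_cast hTn
    have : Nonempty (Fin T) := ⟨⟨0, by omega⟩⟩
    have h := one_sub_le_comp_success (κ := Fin L) (τ := Fin T) (K n) (by simpa using hT2) hδpos
    simp only [Fintype.card_fin, hKn] at h
    refine le_trans ?_ h
    have hn0 : (0 : ℝ) < n := by exact_mod_cast hn
    have hq1 : (1 - 1 / (T : ℝ)) ^ (k * L) ≤ 1 := by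
      have : 1 / (T : ℝ) ≤ 1 := by rw [div_le_one (by linarith)]; linarith
      exact pow_le_one₀ (by linarith) (by linarith [show 0 ≤ 1 / (T : ℝ) by positivity])
    have hpow : n * (1 - ((1 - 1 / (T : ℝ)) ^ (k * L) - δ)) ^ L ≤
        Real.exp (-(γ * Real.log n)) := by
      calc n * (1 - ((1 - 1 / (T : ℝ)) ^ (k * L) - δ)) ^ L ≤ n * r ^ L := by
            refine mul_le_mul_of_nonneg_left (pow_le_pow_left₀ ?_ ?_ L) hn0.le <;> linarith
        _ = Real.exp (Real.log n - L * Real.log 2 / (1 + ε / 4)) := by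
            rw [hr, ← Real.exp_nat_mul, sub_eq_add_neg, Real.exp_add, Real.exp_log hn0]
            congr 2
            ring
        _ ≤ _ := by
            rw [Real.exp_le_exp]
            have h5 := div_le_div_of_nonneg_right hL (show 0 ≤ 1 + ε / 4 by positivity)
            have h6 : Real.log n - (1 + ε / 2) * Real.log n / (1 + ε / 4) =
                -(γ * Real.log n) := by
              rw [hγ]
              field_simp
              ring
            linarith
    linarith
  · refine Eventually.of_forall fun n => div_le_one_of_le₀ ?_ (by positivity)
    refine (Nat.cast_le.2 (Nat.card_le_card_of_injective _ Subtype.val_injective)).trans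
      (le_of_eq ?_)
    simp [← pow_mul, mul_comm]
end

section
/- Fix constants λ > 0 and ε > 0. For each n, let M_n ∈ {0,1}^{T_n × n} be any test matrix with T_n ≤ (1−ε)·(λ/(λ + (log 2)²))·n tests, and let f_n : {0,1}^{T_n} → {0,1}^n be any decoder. Let x ∈ {0,1}^n have i.i.d. entries which are 1 with probability p = λ/log n, and let y ∈ {0,1}^{T_n} be given by y_t = ⋁_{i : (M_n)_{t,i}=1} x_i. Then the success probability Pr[f_n(y) = x] tends to 0 as n → ∞ (equivalently, the error probability is 1 − o(1)). -/
open Filter Finset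

/-- Success probability of design `M` with decoder `f` under the i.i.d. prior with
defective probability `p`: each item is independently defective with probability `p`, test
`t` is positive iff it contains a defective item, and we succeed iff the decoder applied to
the vector of test results returns the defective vector exactly. -/
noncomputable def iidSuccProb {T n : ℕ} (M : Fin T → Fin n → Bool)
    (f : (Fin T → Bool) → (Fin n → Bool)) (p : ℝ) : ℝ :=
  ∑ x : Fin n → Bool,
    (∏ i, (if x i then p else 1 - p)) *
      (if f (fun t => decide (∃ i, M t i = true ∧ x i = true)) = x then (1 : ℝ) else 0)

/-- Probability of the defective vector `x` under the i.i.d. prior. -/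
noncomputable def bernoulliWeight {ι : Type*} [Fintype ι] (p : ℝ) (x : ι → Bool) : ℝ :=
  ∏ i, (if x i then p else 1 - p)

section
variable {ι : Type*} [Fintype ι] [DecidableEq ι] {p : ℝ}

omit [DecidableEq ι] in
lemma bernoulliWeight_nonneg (hp : 0 ≤ p) (hp1 : p ≤ 1) (x : ι → Bool) :
    0 ≤ bernoulliWeight p x :=
  prod_nonneg fun i _ => by split_ifs <;> linarith

lemma sum_bernoulliWeight_mul_prod (p : ℝ) (g : ι → Bool → ℝ) :
    ∑ x : ι → Bool, bernoulliWeight p x * ∏ i, g i (x i) =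
      ∏ i, (p * g i true + (1 - p) * g i false) := by
  have h := Finset.prod_univ_sum (fun _ : ι => (Finset.univ : Finset Bool))
    (fun i b => (if b then p else 1 - p) * g i b)
  simp only [Fintype.piFinset_univ, Fintype.sum_bool] at h
  simp only [bernoulliWeight, ← prod_mul_distrib]
  simpa using h.symm

lemma sum_bernoulliWeight (p : ℝ) : ∑ x : ι → Bool, bernoulliWeight p x = 1 := by
  simpa using sum_bernoulliWeight_mul_prod p (fun (_ : ι) _ => (1 : ℝ))

/-- The probability that all items of `S` are nondefective. -/
lemma sum_bernoulliWeight_forall_false (p : ℝ) (S : Finset ι) :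
    ∑ x : ι → Bool, bernoulliWeight p x * (if ∀ j ∈ S, x j = false then (1 : ℝ) else 0) =
      (1 - p) ^ #S := by
  have h := sum_bernoulliWeight_mul_prod p
    (fun (i : ι) b => if i ∈ S ∧ b = true then (0 : ℝ) else 1)
  have h2 : ∀ x : ι → Bool, (∏ i, if i ∈ S ∧ x i = true then (0 : ℝ) else 1) =
      if ∀ j ∈ S, x j = false then 1 else 0 := by
    intro x
    split_ifs with hx
    · exact prod_eq_one fun i _ => if_neg fun hi => by simp [hx i hi.1] at hi
    · push Not at hx
      obtain ⟨j, hj, hxj⟩ := hx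
      exact prod_eq_zero (mem_univ j) (if_pos ⟨hj, by simpa using hxj⟩)
  simp only [h2] at h
  rw [h]
  simp only [and_true, Bool.false_eq_true, and_false, if_false, mul_one]
  rw [← prod_const, ← Finset.prod_subset (subset_univ S)]
  · exact prod_congr rfl fun i hi => by simp [hi]
  · intro i _ hi
    simp [hi]

lemma sum_bernoulliWeight_exists_true (p : ℝ) (S : Finset ι) :
    ∑ x : ι → Bool, bernoulliWeight p x * (if ∃ j ∈ S, x j = true then (1 : ℝ) else 0) =
      1 - (1 - p) ^ #S := by
  rw [← sum_bernoulliWeight_forall_false p S, eq_sub_iff_add_eq, ← sum_add_distrib]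
  refine Eq.trans (sum_congr rfl fun x _ => ?_) (sum_bernoulliWeight (ι := ι) p)
  by_cases h : ∃ j ∈ S, x j = true
  · have h' : ¬ ∀ j ∈ S, x j = false := by simpa using h
    rw [if_pos h, if_neg h']; ring
  · have h' : ∀ j ∈ S, x j = false := by simpa using h
    rw [if_neg h, if_pos h']; ring

/-- Functions of disjoint sets of coordinates are uncorrelated. -/
lemma sum_bernoulliWeight_mul_of_disjoint (p : ℝ) (S : Finset ι) (F G : (ι → Bool) → ℝ)
    (hF : ∀ x y, (∀ i ∈ S, x i = y i) → F x = F y)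
    (hG : ∀ x y, (∀ i, i ∉ S → x i = y i) → G x = G y) :
    ∑ x, bernoulliWeight p x * (F x * G x) =
      (∑ x, bernoulliWeight p x * F x) * ∑ x, bernoulliWeight p x * G x := by
  let mix : (ι → Bool) → (ι → Bool) → (ι → Bool) := fun x y => S.piecewise x y
  let e : ((ι → Bool) × (ι → Bool)) → ((ι → Bool) × (ι → Bool)) :=
    fun z => (mix z.1 z.2, mix z.2 z.1)
  have he : Function.Involutive e := by
    rintro ⟨x, y⟩
    ext i <;> by_cases hi : i ∈ S <;> simp [e, mix, hi]
  have hw : ∀ x y, bernoulliWeight p (mix x y) * bernoulliWeight p (mix y x) =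
      bernoulliWeight p x * bernoulliWeight p y := by
    intro x y
    simp only [bernoulliWeight, ← prod_mul_distrib]
    refine prod_congr rfl fun i _ => ?_
    by_cases hi : i ∈ S
    · simp [mix, hi]
    · simp only [mix, Finset.piecewise, hi, if_false]
      exact mul_comm _ _
  calc ∑ x, bernoulliWeight p x * (F x * G x)
      = (∑ x, bernoulliWeight p x * (F x * G x)) * ∑ y : ι → Bool, bernoulliWeight p y := by
        rw [sum_bernoulliWeight, mul_one]
    _ = ∑ z : (ι → Bool) × (ι → Bool),
          bernoulliWeight p z.1 * (F z.1 * G z.1) * bernoulliWeight p z.2 := by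
        rw [sum_mul_sum, Fintype.sum_prod_type]
    _ = ∑ z : (ι → Bool) × (ι → Bool),
          bernoulliWeight p z.1 * F z.1 * (bernoulliWeight p z.2 * G z.2) := by
        rw [← Equiv.sum_comp he.toPerm]
        refine sum_congr rfl fun z _ => ?_
        have h1 : F (mix z.1 z.2) = F z.1 := hF _ _ fun i hi => by simp [mix, hi]
        have h2 : G (mix z.1 z.2) = G z.2 := hG _ _ fun i hi => by simp [mix, hi]
        have h3 := hw z.1 z.2
        simp only [Function.Involutive.coe_toPerm, e, h1, h2]
        linear_combination (F z.1 * G z.2) * h3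
    _ = _ := by rw [sum_mul_sum, Fintype.sum_prod_type]

omit [DecidableEq ι] in
lemma bernoulliWeight_mul_inf_sup (p : ℝ) (x y : ι → Bool) :
    bernoulliWeight p x * bernoulliWeight p y =
      bernoulliWeight p (x ⊓ y) * bernoulliWeight p (x ⊔ y) := by
  simp only [bernoulliWeight, ← prod_mul_distrib]
  refine prod_congr rfl fun i _ => ?_
  rcases hx : x i <;> rcases hy : y i <;> simp [hx, hy, mul_comm]

/-- Harris' inequality for finitely many nonnegative increasing functions. -/
lemma prod_sum_bernoulliWeight_le {τ : Type*} [DecidableEq τ] (hp : 0 ≤ p) (hp1 : p ≤ 1)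
    (U : Finset τ) (F : τ → (ι → Bool) → ℝ) (hF0 : ∀ t x, 0 ≤ F t x)
    (hF : ∀ t, Monotone (F t)) :
    ∏ t ∈ U, ∑ x, bernoulliWeight p x * F t x ≤
      ∑ x, bernoulliWeight p x * ∏ t ∈ U, F t x := by
  induction U using Finset.induction_on with
  | empty => simp [sum_bernoulliWeight]
  | insert t U ht ih =>
    have hw : ∀ x : ι → Bool, 0 ≤ bernoulliWeight p x := bernoulliWeight_nonneg hp hp1
    rw [prod_insert ht]
    simp only [prod_insert ht]
    have hmono : Monotone fun x => ∏ t ∈ U, F t x := fun x y hxy =>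
      prod_le_prod (fun s _ => hF0 s x) fun s _ => hF s hxy
    have h := fkg (μ := bernoulliWeight (ι := ι) p) (f := F t) (g := fun x => ∏ t ∈ U, F t x)
      hw (hF0 t) (fun x => prod_nonneg fun s _ => hF0 s x) (hF t) hmono
      (fun x y => (bernoulliWeight_mul_inf_sup p x y).le)
    rw [sum_bernoulliWeight, one_mul] at h
    exact (mul_le_mul_of_nonneg_left ih
      (sum_nonneg fun x _ => mul_nonneg (hw x) (hF0 t x))).trans h

lemma mul_bernoulliWeight_le_flip (hp : 0 ≤ p) (hp1 : p ≤ 1 / 2) (x : ι → Bool) (i : ι) :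
    p * bernoulliWeight p x ≤ bernoulliWeight p (Function.update x i (!x i)) := by
  unfold bernoulliWeight
  rw [← mul_prod_erase univ _ (mem_univ i), ← mul_prod_erase univ _ (mem_univ i), ← mul_assoc]
  have h : ∏ j ∈ univ.erase i, (if Function.update x i (!x i) j = true then p else 1 - p) =
      ∏ j ∈ univ.erase i, (if x j = true then p else 1 - p) :=
    prod_congr rfl fun j hj => by rw [Function.update_of_ne (ne_of_mem_erase hj)]
  rw [h]
  refine mul_le_mul_of_nonneg_right ?_ (prod_nonneg fun j _ => by split_ifs <;> linarith)
  rcases hx : x i <;> simp <;> nlinarith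

end

/-- Lower-tail Chebyshev bound for a sum of indicators with few correlated pairs. -/
lemma lower_tail_of_few_dependencies {Ω κ : Type*} [Fintype Ω] [DecidableEq κ] (w : Ω → ℝ)
    (hw : ∀ x, 0 ≤ w x) (hw1 : ∑ x, w x = 1) (A : κ → Ω → Prop) [∀ i x, Decidable (A i x)]
    (G : Finset κ) (dep : κ → κ → Prop) [∀ i j, Decidable (dep i j)] (D m : ℝ) (hm : 0 < m)
    (hD : ∀ i ∈ G, (#{j ∈ G | dep i j} : ℝ) ≤ D)
    (hdep : ∀ i ∈ G, ∀ j ∈ G, ¬ dep i j →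
      ∑ x, w x * ((if A i x then (1 : ℝ) else 0) * (if A j x then 1 else 0)) =
        (∑ x, w x * (if A i x then (1 : ℝ) else 0)) * ∑ x, w x * (if A j x then (1 : ℝ) else 0))
    (hmean : m ≤ ∑ i ∈ G, ∑ x, w x * (if A i x then (1 : ℝ) else 0)) :
    ∑ x, w x * (if (#{i ∈ G | A i x} : ℝ) < m / 2 then (1 : ℝ) else 0) ≤ 4 * D / m := by
  set P : κ → ℝ := fun i => ∑ x, w x * (if A i x then (1 : ℝ) else 0) with hP
  set μ : ℝ := ∑ i ∈ G, P i with hμ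
  have hμ0 : 0 < μ := hm.trans_le hmean
  have hP0 : ∀ i, 0 ≤ P i := fun i =>
    sum_nonneg fun x _ => mul_nonneg (hw x) (by split_ifs <;> norm_num)
  set N : Ω → ℝ := fun x => ∑ i ∈ G, if A i x then (1 : ℝ) else 0 with hN
  have hcard : ∀ x, (#{i ∈ G | A i x} : ℝ) = N x := fun x => by simp [hN]
  have hEN : ∑ x, w x * N x = μ := by
    simp only [hN, hμ, hP, mul_sum]
    exact sum_comm
  have hsq : ∑ x, w x * N x ^ 2 =
      ∑ i ∈ G, ∑ j ∈ G,
        ∑ x, w x * ((if A i x then (1 : ℝ) else 0) * (if A j x then 1 else 0)) := by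
    simp only [hN, sq, sum_mul_sum]
    simp only [mul_sum]
    rw [sum_comm]
    exact sum_congr rfl fun i _ => sum_comm
  have hvar : ∑ x, w x * (N x - μ) ^ 2 ≤ D * μ := by
    have h1 : ∑ x, w x * (N x - μ) ^ 2 = ∑ x, w x * N x ^ 2 - μ ^ 2 := by
      have : ∀ x, w x * (N x - μ) ^ 2 = w x * N x ^ 2 - 2 * μ * (w x * N x) + μ ^ 2 * w x :=
        fun x => by ring
      simp only [this, sum_add_distrib, sum_sub_distrib, ← mul_sum, hEN, hw1]
      ring
    have h2 : μ ^ 2 = ∑ i ∈ G, ∑ j ∈ G, P i * P j := by rw [sq, hμ, sum_mul_sum]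
    rw [h1, hsq, h2, ← sum_sub_distrib, hμ, mul_sum]
    refine sum_le_sum fun i hi => ?_
    rw [← sum_sub_distrib]
    calc _ ≤ ∑ j ∈ G, (if dep i j then P i else 0) := by
          refine sum_le_sum fun j hj => ?_
          split_ifs with hd
          · have h3 : ∑ x, w x * ((if A i x then (1 : ℝ) else 0) * (if A j x then 1 else 0)) ≤
                P i := by
              refine sum_le_sum fun x _ => mul_le_mul_of_nonneg_left ?_ (hw x)
              split_ifs <;> norm_num
            have := mul_nonneg (hP0 i) (hP0 j)
            linarith
          · exact (sub_eq_zero.2 (hdep i hi j hj hd)).le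
      _ = #{j ∈ G | dep i j} * P i := by rw [← sum_filter, sum_const, nsmul_eq_mul]
      _ ≤ D * P i := mul_le_mul_of_nonneg_right (hD i hi) (hP0 i)
  have hD0 : 0 ≤ D := by
    have : 0 ≤ D * μ :=
      (sum_nonneg fun x _ => mul_nonneg (hw x) (sq_nonneg _)).trans hvar
    exact nonneg_of_mul_nonneg_left this hμ0
  have hcheb : (∑ x, w x * (if (#{i ∈ G | A i x} : ℝ) < m / 2 then (1 : ℝ) else 0)) *
      (μ ^ 2 / 4) ≤ D * μ := by
    refine le_trans ?_ hvar
    rw [sum_mul]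
    refine sum_le_sum fun x _ => ?_
    rw [mul_assoc]
    refine mul_le_mul_of_nonneg_left ?_ (hw x)
    rw [hcard]
    split_ifs with h
    · nlinarith
    · simpa using sq_nonneg _
  calc _ ≤ 4 * D / μ := by
        rw [le_div_iff₀ hμ0]
        refine le_of_mul_le_mul_right ?_ hμ0
        linarith
    _ ≤ 4 * D / m := div_le_div_of_nonneg_left (by positivity) hm hmean

lemma log_mul_log_one_sub_le {u : ℝ} (h0 : 0 < u) (h1 : u < 1) :
    Real.log u * Real.log (1 - u) ≤ Real.log 2 ^ 2 := by
  have hmono : MonotoneOn (fun u : ℝ => Real.log u * Real.log (1 - u)) (Set.Ioc 0 (1 / 2)) := by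
    have hder : ∀ v ∈ Set.Ioc (0 : ℝ) (1 / 2),
        HasDerivAt (fun u : ℝ => Real.log u * Real.log (1 - u))
          (v⁻¹ * Real.log (1 - v) + Real.log v * (-1 / (1 - v))) v := fun v hv =>
      (Real.hasDerivAt_log hv.1.ne').mul
        (((hasDerivAt_id v).const_sub 1).log (by simp only [id]; linarith [hv.2]))
    refine monotoneOn_of_deriv_nonneg (convex_Ioc _ _)
      (fun v hv => (hder v hv).continuousAt.continuousWithinAt)
      (fun v hv => (hder v (interior_subset hv)).differentiableAt.differentiableWithinAt)
      fun v hv => ?_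
    have hv' := interior_subset hv
    rw [(hder v hv').deriv]
    have hv0 : 0 < v := hv'.1
    have hv1 : 0 < 1 - v := by linarith [hv'.2]
    have hs := strictConcaveOn_log_Ioi.concaveOn.slope_anti (x := 1) (by simp)
      (a := v) ⟨hv0, by simp; linarith⟩ (b := 1 - v) ⟨hv1, by simp; linarith⟩ (by linarith [hv'.2])
    simp only [slope_def_field, Real.log_one, sub_zero] at hs
    have e1 : Real.log (1 - v) / (1 - v - 1) = -(v⁻¹ * Real.log (1 - v)) := by
      rw [show 1 - v - 1 = -v by ring, div_neg, div_eq_inv_mul]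
    have e2 : Real.log v / (v - 1) = Real.log v * (-1 / (1 - v)) := by
      rw [← neg_sub 1 v, div_neg]; ring
    rw [e1, e2] at hs
    linarith
  have key : ∀ v : ℝ, 0 < v → v ≤ 1 / 2 → Real.log v * Real.log (1 - v) ≤ Real.log 2 ^ 2 := by
    intro v hv hv2
    refine (hmono ⟨hv, hv2⟩ ⟨by norm_num, le_rfl⟩ hv2).trans (le_of_eq ?_)
    dsimp only
    rw [show (1 : ℝ) - 1 / 2 = 2⁻¹ by norm_num, one_div, Real.log_inv]
    ring
  rcases le_total u (1 / 2) with h | h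
  · exact key u h0 h
  · have := key (1 - u) (by linarith) (by linarith)
    rwa [sub_sub_cancel, mul_comm] at this

section
variable {ι τ : Type*} [Fintype ι] [DecidableEq ι]

/-- Every test containing `i` also contains a defective item other than `i`. -/
def IsMasked (M : τ → ι → Bool) (i : ι) (x : ι → Bool) : Prop :=
  ∀ t, M t i = true → ∃ j, j ≠ i ∧ M t j = true ∧ x j = true

omit [Fintype ι] in
lemma IsMasked.result_update_iff {M : τ → ι → Bool} {i : ι} {x : ι → Bool} (h : IsMasked M i x)
    (b : Bool) (t : τ) :
    (∃ j, M t j = true ∧ Function.update x i b j = true) ↔ ∃ j, M t j = true ∧ x j = true := by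
  by_cases hti : M t i = true
  · obtain ⟨j, hj, hMj, hxj⟩ := h t hti
    exact ⟨fun _ => ⟨j, hMj, hxj⟩, fun _ => ⟨j, hMj, by rwa [Function.update_of_ne hj]⟩⟩
  · refine exists_congr fun j => and_congr_right fun hj => ?_
    rw [Function.update_of_ne (by rintro rfl; exact hti hj)]

open Classical in
/-- A decoder can only succeed if few items are masked. -/
lemma iidSuccProb_le_of_masked {T n : ℕ} (M : Fin T → Fin n → Bool)
    (f : (Fin T → Bool) → (Fin n → Bool)) {p K : ℝ} (hp : 0 < p) (hp1 : p ≤ 1 / 2) (hK : 0 < K) :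
    iidSuccProb M f p ≤
      ∑ x, bernoulliWeight p x * (if (#{i | IsMasked M i x} : ℝ) < K then (1 : ℝ) else 0) +
        1 / (p * K) := by
  set res : (Fin n → Bool) → (Fin T → Bool) :=
    fun x t => decide (∃ i, M t i = true ∧ x i = true) with hres
  set flip : Fin n → (Fin n → Bool) → (Fin n → Bool) :=
    fun i x => Function.update x i (!x i) with hflip
  have hinv : ∀ i, Function.Involutive (flip i) := by
    intro i x
    ext j
    by_cases hj : j = i
    · subst hj; simp [hflip]
    · simp [hflip, Function.update_of_ne hj]
  have hne : ∀ i j x, flip i x = flip j x → i = j := by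
    intro i j x h
    by_contra hij
    have := congrFun h i
    simp [hflip, Function.update_of_ne hij] at this
  have hw : ∀ x : Fin n → Bool, 0 ≤ bernoulliWeight p x :=
    bernoulliWeight_nonneg hp.le (by linarith)
  set ok : Fin n → (Fin n → Bool) → ℝ :=
    fun i x => if f (res x) = x ∧ IsMasked M i x then 1 else 0 with hok
  have htotal : ∑ x, ∑ i, bernoulliWeight p (flip i x) * ok i x ≤ 1 := by
    rw [← sum_bernoulliWeight (ι := Fin n) p, sum_comm]
    have hre : ∀ i, ∑ x, bernoulliWeight p (flip i x) * ok i x =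
        ∑ x, bernoulliWeight p x * ok i (flip i x) := by
      intro i
      rw [← Equiv.sum_comp (hinv i).toPerm]
      simp only [Function.Involutive.coe_toPerm, hinv i _]
    simp only [hre]
    rw [sum_comm]
    refine sum_le_sum fun x _ => ?_
    rw [← mul_sum]
    refine mul_le_of_le_one_right (hw x) ?_
    have hdec : ∀ i, f (res (flip i x)) = flip i x ∧ IsMasked M i (flip i x) →
        f (res x) = flip i x := by
      rintro i ⟨h1, h2⟩
      have h3 : res (flip i (flip i x)) = res (flip i x) :=
        funext fun t => decide_eq_decide.2 (h2.result_update_iff (!(flip i x) i) t)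
      rw [hinv i x] at h3
      rw [h3, h1]
    simp only [hok, sum_boole]
    have : #{i | f (res (flip i x)) = flip i x ∧ IsMasked M i (flip i x)} ≤ 1 := by
      refine card_le_one.2 fun i hi j hj => hne i j x ?_
      rw [← hdec i (mem_filter.1 hi).2, ← hdec j (mem_filter.1 hj).2]
    exact_mod_cast this
  have hmain : ∀ x, bernoulliWeight p x * (if f (res x) = x then (1 : ℝ) else 0) ≤
      bernoulliWeight p x * (if (#{i | IsMasked M i x} : ℝ) < K then (1 : ℝ) else 0) +
        1 / (p * K) * ∑ i, bernoulliWeight p (flip i x) * ok i x := by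
    intro x
    have hsum0 : 0 ≤ ∑ i, bernoulliWeight p (flip i x) * ok i x :=
      sum_nonneg fun i _ => mul_nonneg (hw _) (by simp only [hok]; split_ifs <;> norm_num)
    have hpK : 0 < p * K := mul_pos hp hK
    by_cases hx : f (res x) = x
    · by_cases hN : (#{i | IsMasked M i x} : ℝ) < K
      · rw [if_pos hx, if_pos hN]
        have := mul_nonneg (one_div_nonneg.2 hpK.le) hsum0
        linarith
      · rw [if_pos hx, if_neg hN, mul_one, mul_zero, zero_add]
        push Not at hN
        have h1 : p * bernoulliWeight p x * #{i | IsMasked M i x} ≤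
            ∑ i, bernoulliWeight p (flip i x) * ok i x := by
          rw [mul_comm, ← nsmul_eq_mul, ← sum_const, sum_filter]
          refine sum_le_sum fun i _ => ?_
          by_cases hm : IsMasked M i x
          · simp only [hok, hx, hm, and_self, if_true, mul_one]
            exact mul_bernoulliWeight_le_flip hp.le hp1 x i
          · simp [hok, hm]
        have h2 : p * bernoulliWeight p x * K ≤ p * bernoulliWeight p x * #{i | IsMasked M i x} :=
          mul_le_mul_of_nonneg_left hN (mul_nonneg hp.le (hw x))
        rw [one_div, inv_mul_eq_div, le_div_iff₀ hpK]
        linarith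
    · rw [if_neg hx, mul_zero]
      have := mul_nonneg (one_div_nonneg.2 hpK.le) hsum0
      refine add_nonneg (mul_nonneg (hw x) (by split_ifs <;> norm_num)) this
  calc iidSuccProb M f p = ∑ x, bernoulliWeight p x * (if f (res x) = x then (1 : ℝ) else 0) := rfl
    _ ≤ _ := sum_le_sum fun x _ => hmain x
    _ ≤ _ := by
      rw [sum_add_distrib, ← mul_sum]
      have := mul_le_mul_of_nonneg_left htotal (one_div_nonneg.2 (mul_pos hp hK).le)
      linarith

end

section
variable {ι τ : Type*} [Fintype ι] [Fintype τ] [DecidableEq ι] [DecidableEq τ]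

/-- The tests of size at most `s` containing item `i`. -/
def smallTests (M : τ → ι → Bool) (s : ℕ) (i : ι) : Finset τ :=
  {t | M t i = true ∧ #{j | M t j = true} ≤ s}

/-- The items contained in at most `s ^ 2` tests of size at most `s`. -/
def lightItems (M : τ → ι → Bool) (s : ℕ) : Finset ι := {i | #(smallTests M s i) ≤ s ^ 2}

/-- The light items contained in the test `t`. -/
def lightRow (M : τ → ι → Bool) (s : ℕ) (t : τ) : Finset ι := {j ∈ lightItems M s | M t j = true}

/-- Every small test containing `i` also contains a light defective item other than `i`. -/
def IsLocallyMasked (M : τ → ι → Bool) (s : ℕ) (i : ι) (x : ι → Bool) : Prop :=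
  ∀ t ∈ smallTests M s i, ∃ j ∈ (lightRow M s t).erase i, x j = true

/-- The light items all of whose small tests contain a further light item. -/
def candidates (M : τ → ι → Bool) (s : ℕ) : Finset ι :=
  {i ∈ lightItems M s | ∀ t ∈ smallTests M s i, 2 ≤ #(lightRow M s t)}

instance (M : τ → ι → Bool) (s : ℕ) (i : ι) (x : ι → Bool) :
    Decidable (IsLocallyMasked M s i x) := by
  unfold IsLocallyMasked; infer_instance

variable (M : τ → ι → Bool) (s : ℕ)

omit [DecidableEq τ] in
lemma card_heavy_mul_le : #(lightItems M s)ᶜ * s ^ 2 ≤ Fintype.card τ * s := by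
  calc #(lightItems M s)ᶜ * s ^ 2 = ∑ i ∈ (lightItems M s)ᶜ, s ^ 2 := by simp
    _ ≤ ∑ i ∈ (lightItems M s)ᶜ, #(smallTests M s i) := sum_le_sum fun i hi => by
        simp [lightItems] at hi; exact hi.le
    _ ≤ ∑ i, #(smallTests M s i) := sum_le_sum_of_subset (subset_univ _)
    _ = ∑ t : τ, #{i | M t i = true ∧ #{j | M t j = true} ≤ s} := by
        simp only [smallTests, card_filter]
        exact sum_comm
    _ ≤ ∑ _t : τ, s := sum_le_sum fun t _ => by
        by_cases h : #{j | M t j = true} ≤ s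
        · simp [h]
        · simp [h]
    _ = Fintype.card τ * s := by simp

omit [DecidableEq ι] in
lemma candidates_subset_lightItems : candidates M s ⊆ lightItems M s := filter_subset _ _

lemma card_light_sdiff_candidates_le :
    #(lightItems M s \ candidates M s) ≤ Fintype.card τ := by
  have hsub : lightItems M s \ candidates M s ⊆
      ({t | #(lightRow M s t) ≤ 1} : Finset τ).biUnion (lightRow M s) := by
    intro i hi
    obtain ⟨hl, hc⟩ := mem_sdiff.1 hi
    simp only [candidates, mem_filter, hl, true_and, not_forall] at hc
    obtain ⟨t, ht, hlt⟩ := hc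
    have htM : M t i = true := (mem_filter.1 ht).2.1
    exact mem_biUnion.2 ⟨t, by simp; omega, mem_filter.2 ⟨hl, htM⟩⟩
  refine (card_le_card hsub).trans ((card_biUnion_le_card_mul _ _ 1 fun t ht => ?_).trans ?_)
  · exact (mem_filter.1 ht).2
  · rw [mul_one]; exact card_le_univ _

lemma card_candidates_ge (hs : 0 < s) :
    (Fintype.card ι : ℝ) - Fintype.card τ - Fintype.card τ / s ≤ #(candidates M s) := by
  have h1 : (#(lightItems M s)ᶜ : ℝ) ≤ Fintype.card τ / s := by
    have hs' : (0 : ℝ) < s := by exact_mod_cast hs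
    rw [le_div_iff₀ hs']
    have : (#(lightItems M s)ᶜ : ℝ) * s ^ 2 ≤ Fintype.card τ * s := by
      exact_mod_cast card_heavy_mul_le M s
    nlinarith
  have h2 : (#(lightItems M s \ candidates M s) : ℝ) ≤ Fintype.card τ := by
    exact_mod_cast card_light_sdiff_candidates_le M s
  have h3 : (#(lightItems M s \ candidates M s) : ℝ) + #(candidates M s) = #(lightItems M s) := by
    exact_mod_cast card_sdiff_add_card_eq_card (filter_subset _ _)
  have h4 : (#(lightItems M s) : ℝ) + #(lightItems M s)ᶜ = Fintype.card ι := by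
    exact_mod_cast card_add_card_compl _
  linarith

/-- Two items are dependent if they have small tests with a common light item. -/
def Dependent (i j : ι) : Prop :=
  ∃ t ∈ smallTests M s i, ∃ t' ∈ smallTests M s j, ¬ Disjoint (lightRow M s t) (lightRow M s t')

instance (i j : ι) : Decidable (Dependent M s i j) := by
  unfold Dependent; infer_instance

omit [DecidableEq τ] in
lemma card_dependent_le {i : ι} (hi : i ∈ lightItems M s) (G : Finset ι) :
    #{j ∈ G | Dependent M s i j} ≤ s ^ 6 := by
  have hsub : {j ∈ G | Dependent M s i j} ⊆
      (smallTests M s i).biUnion fun t => ({k ∈ lightRow M s t | #{j | M t j = true} ≤ s}).biUnion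
        fun k => (smallTests M s k).biUnion fun t' => {j | M t' j = true} := by
    intro j hj
    obtain ⟨t, ht, t', ht', hd⟩ := (mem_filter.1 hj).2
    obtain ⟨k, hk, hk'⟩ := not_disjoint_iff.1 hd
    have hts := (mem_filter.1 ht).2.2
    have hts' := (mem_filter.1 ht').2
    refine mem_biUnion.2 ⟨t, ht, mem_biUnion.2 ⟨k, mem_filter.2 ⟨hk, hts⟩,
      mem_biUnion.2 ⟨t', ?_, ?_⟩⟩⟩
    · exact mem_filter.2 ⟨mem_univ _, (mem_filter.1 hk').2, hts'.2⟩
    · simpa using hts'.1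
  refine (card_le_card hsub).trans ?_
  have hb := card_biUnion_le_card_mul (smallTests M s i) (fun t =>
    ({k ∈ lightRow M s t | #{j | M t j = true} ≤ s}).biUnion
      fun k => (smallTests M s k).biUnion fun t' => {j | M t' j = true}) (s * (s ^ 2 * s)) ?_
  · refine hb.trans ((Nat.mul_le_mul_right _ (mem_filter.1 hi).2).trans (le_of_eq (by ring)))
  · intro t ht
    refine (card_biUnion_le_card_mul _ _ (s ^ 2 * s) fun k hk => ?_).trans
      (Nat.mul_le_mul_right _ ?_)
    · refine (card_biUnion_le_card_mul _ _ s fun t' ht' => (mem_filter.1 ht').2.2).trans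
        (Nat.mul_le_mul_right _ ?_)
      exact (mem_filter.1 (mem_filter.1 (mem_filter.1 hk).1).1).2
    · refine le_trans (card_le_card fun k hk => ?_) (mem_filter.1 ht).2.2
      simpa using (mem_filter.1 (mem_filter.1 hk).1).2

omit [DecidableEq τ] in
lemma isLocallyMasked_congr {i : ι} {x y : ι → Bool}
    (h : ∀ j ∈ (smallTests M s i).biUnion (lightRow M s), x j = y j) :
    IsLocallyMasked M s i x ↔ IsLocallyMasked M s i y := by
  refine forall₂_congr fun t ht => exists_congr fun j => and_congr_right fun hj => ?_
  rw [h j (mem_biUnion.2 ⟨t, ht, mem_of_mem_erase hj⟩)]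

lemma uncorrelated_of_not_dependent (p : ℝ) {i j : ι} (h : ¬ Dependent M s i j) :
    ∑ x, bernoulliWeight p x * ((if IsLocallyMasked M s i x then (1 : ℝ) else 0) *
        (if IsLocallyMasked M s j x then 1 else 0)) =
      (∑ x, bernoulliWeight p x * (if IsLocallyMasked M s i x then (1 : ℝ) else 0)) *
        ∑ x, bernoulliWeight p x * (if IsLocallyMasked M s j x then (1 : ℝ) else 0) := by
  refine sum_bernoulliWeight_mul_of_disjoint p ((smallTests M s i).biUnion (lightRow M s)) _ _
    (fun x y hxy => ?_) fun x y hxy => ?_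
  · simp only [isLocallyMasked_congr M s hxy]
  · have := isLocallyMasked_congr M s (i := j) (x := x) (y := y) fun k hk => hxy k fun hk' => by
      obtain ⟨t', ht', hkt'⟩ := mem_biUnion.1 hk
      obtain ⟨t, ht, hkt⟩ := mem_biUnion.1 hk'
      exact h ⟨t, ht, t', ht', not_disjoint_iff.2 ⟨k, hkt, hkt'⟩⟩
    simp only [this]

/-- Minus the logarithm of the probability that one of `d - 1` items is defective. -/
noncomputable def maskCost (p : ℝ) (d : ℕ) : ℝ := -Real.log (1 - (1 - p) ^ (d - 1))

lemma maskCost_nonneg {p : ℝ} (hp : 0 ≤ p) (hp1 : p ≤ 1) (d : ℕ) : 0 ≤ maskCost p d := by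
  have h0 : 0 ≤ (1 - p) ^ (d - 1) := pow_nonneg (by linarith) _
  have h1 : (1 - p) ^ (d - 1) ≤ 1 := pow_le_one₀ (by linarith) (by linarith)
  exact neg_nonneg.2 (Real.log_nonpos (by linarith) (by linarith))

lemma mul_maskCost_le {p : ℝ} (hp : 0 < p) (hp1 : p < 1) {d : ℕ} (hd : 2 ≤ d) :
    d * maskCost p d ≤ Real.log 2 ^ 2 / p + Real.log (1 / p) := by
  obtain ⟨k, rfl⟩ : ∃ k, d = k + 1 + 1 := ⟨d - 2, by omega⟩
  have hq : 0 < 1 - p := by linarith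
  set u : ℝ := (1 - p) ^ (k + 1) with hu
  have hu0 : 0 < u := pow_pos hq _
  have hup : u ≤ 1 - p := pow_le_of_le_one hq.le (by linarith) (by omega)
  have hlogu : Real.log u = ((k + 1 : ℕ) : ℝ) * Real.log (1 - p) := by rw [hu, Real.log_pow]
  have hlogp : Real.log (1 - p) ≤ -p := by
    have := Real.log_le_sub_one_of_pos hq; linarith
  have hkp : ((k + 1 : ℕ) : ℝ) * p ≤ -Real.log u := by
    rw [hlogu]; nlinarith [Nat.cast_nonneg (α := ℝ) (k + 1)]
  have hc : Real.log (1 - u) ≤ 0 := Real.log_nonpos (by linarith) (by linarith)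
  have h1 : ((k + 1 : ℕ) : ℝ) * -Real.log (1 - u) ≤ Real.log 2 ^ 2 / p := by
    rw [le_div_iff₀ hp]
    have := log_mul_log_one_sub_le hu0 (by linarith : u < 1)
    nlinarith
  have h2 : -Real.log (1 - u) ≤ Real.log (1 / p) := by
    rw [one_div, Real.log_inv]
    exact neg_le_neg (Real.log_le_log hp (by linarith))
  have h3 : maskCost p (k + 1 + 1) = -Real.log (1 - u) := by simp [maskCost, hu]
  rw [h3]
  push_cast at h1 ⊢
  linarith

lemma exp_neg_cost_le_prob {p : ℝ} (hp : 0 < p) (hp1 : p < 1) {i : ι}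
    (hi : i ∈ candidates M s) :
    Real.exp (-∑ t ∈ smallTests M s i, maskCost p #(lightRow M s t)) ≤
      ∑ x, bernoulliWeight p x * (if IsLocallyMasked M s i x then (1 : ℝ) else 0) := by
  have hl : i ∈ lightItems M s := (mem_filter.1 hi).1
  have h := prod_sum_bernoulliWeight_le (ι := ι) hp.le hp1.le (smallTests M s i)
    (fun t x => if ∃ j ∈ (lightRow M s t).erase i, x j = true then (1 : ℝ) else 0)
    (fun t x => by split_ifs <;> norm_num) (fun t x y hxy => by
      dsimp only
      split_ifs with h1 h2
      · exact le_rfl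
      · obtain ⟨j, hj, hxj⟩ := h1
        have hle := hxy j
        rw [hxj] at hle
        exact absurd ⟨j, hj, top_le_iff.1 hle⟩ h2
      · norm_num
      · exact le_rfl)
  simp only [sum_bernoulliWeight_exists_true] at h
  refine le_trans (le_of_eq ?_) (h.trans (le_of_eq ?_))
  · rw [← sum_neg_distrib, Real.exp_sum]
    refine prod_congr rfl fun t ht => ?_
    have hit : i ∈ lightRow M s t := mem_filter.2 ⟨hl, (mem_filter.1 ht).2.1⟩
    have h2 : 2 ≤ #(lightRow M s t) := (mem_filter.1 hi).2 t ht
    have hlt : (1 - p) ^ (#(lightRow M s t) - 1) < 1 :=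
      pow_lt_one₀ (by linarith) (by linarith) (by omega)
    rw [maskCost, neg_neg, card_erase_of_mem hit, Real.exp_log (by linarith)]
  · refine sum_congr rfl fun x _ => ?_
    rw [prod_boole]
    unfold IsLocallyMasked
    congr

omit [DecidableEq ι] in
lemma sum_cost_le {p : ℝ} (hp : 0 < p) (hp1 : p < 1) :
    ∑ i ∈ candidates M s, ∑ t ∈ smallTests M s i, maskCost p #(lightRow M s t) ≤
      Fintype.card τ * (Real.log 2 ^ 2 / p + Real.log (1 / p)) := by
  have hB : 0 ≤ Real.log 2 ^ 2 / p + Real.log (1 / p) :=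
    add_nonneg (by positivity) (Real.log_nonneg (by rw [le_div_iff₀ hp]; linarith))
  calc _ = ∑ i ∈ candidates M s, ∑ t, if t ∈ smallTests M s i then
        maskCost p #(lightRow M s t) else 0 :=
        sum_congr rfl fun i _ => by rw [← sum_filter]; simp
    _ = ∑ t, #{i ∈ candidates M s | t ∈ smallTests M s i} * maskCost p #(lightRow M s t) := by
        rw [sum_comm]
        refine sum_congr rfl fun t _ => ?_
        rw [← sum_filter, sum_const, nsmul_eq_mul]
    _ ≤ ∑ _t : τ, (Real.log 2 ^ 2 / p + Real.log (1 / p)) := by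
        refine sum_le_sum fun t _ => ?_
        rcases ({i ∈ candidates M s | t ∈ smallTests M s i}).eq_empty_or_nonempty with h | ⟨i, hi⟩
        · rw [h]; simpa using hB
        · have h2 := (mem_filter.1 (mem_filter.1 hi).1).2 t (mem_filter.1 hi).2
          refine le_trans (mul_le_mul_of_nonneg_right ?_ (maskCost_nonneg hp.le hp1.le _))
            (mul_maskCost_le hp hp1 h2)
          refine Nat.cast_le.2 (card_le_card fun j hj => ?_)
          exact mem_filter.2 ⟨(mem_filter.1 (mem_filter.1 hj).1).1,
            (mem_filter.1 (mem_filter.1 hj).2).2.1⟩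
    _ = _ := by rw [sum_const, nsmul_eq_mul, card_univ]

lemma card_cheap_ge {p a : ℝ} (hp : 0 < p) (hp1 : p < 1) (ha : 0 < a) (hs : 0 < s) :
    (Fintype.card ι : ℝ) - Fintype.card τ - Fintype.card τ / s -
        Fintype.card τ * (Real.log 2 ^ 2 / p + Real.log (1 / p)) / a ≤
      #{i ∈ candidates M s | ∑ t ∈ smallTests M s i, maskCost p #(lightRow M s t) ≤ a} := by
  set c : ι → ℝ := fun i => ∑ t ∈ smallTests M s i, maskCost p #(lightRow M s t)
  have hc : ∀ i, 0 ≤ c i := fun i => sum_nonneg fun t _ => maskCost_nonneg hp.le hp1.le _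
  have h1 : (#{i ∈ candidates M s | ¬ c i ≤ a} : ℝ) ≤
      Fintype.card τ * (Real.log 2 ^ 2 / p + Real.log (1 / p)) / a := by
    rw [le_div_iff₀ ha, ← nsmul_eq_mul, ← sum_const]
    calc _ ≤ ∑ i ∈ candidates M s with ¬ c i ≤ a, c i :=
          sum_le_sum fun i hi => (not_le.1 (mem_filter.1 hi).2).le
      _ ≤ ∑ i ∈ candidates M s, c i :=
          sum_le_sum_of_subset_of_nonneg (filter_subset _ _) fun i _ _ => hc i
      _ ≤ _ := sum_cost_le M s hp hp1
  have h2 : (#{i ∈ candidates M s | c i ≤ a} : ℝ) + #{i ∈ candidates M s | ¬ c i ≤ a} =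
      #(candidates M s) := by
    exact_mod_cast card_filter_add_card_filter_not _
  have h3 := card_candidates_ge M s hs
  linarith

/-- Every test of size larger than `s` contains a defective item besides any given one. -/
def LargeTestsSaturated (x : ι → Bool) : Prop :=
  ∀ t, s < #{j | M t j = true} → ∀ i, ∃ j ∈ ({j | M t j = true} : Finset ι).erase i, x j = true

instance (x : ι → Bool) : Decidable (LargeTestsSaturated M s x) := by
  unfold LargeTestsSaturated; infer_instance

omit [DecidableEq τ] in
lemma prob_not_largeTestsSaturated_le {p : ℝ} (hp : 0 ≤ p) (hp1 : p ≤ 1) :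
    ∑ x, bernoulliWeight p x * (if ¬ LargeTestsSaturated M s x then (1 : ℝ) else 0) ≤
      Fintype.card τ * Fintype.card ι * (1 - p) ^ s := by
  have hw : ∀ x : ι → Bool, 0 ≤ bernoulliWeight p x := bernoulliWeight_nonneg hp hp1
  have hq : 0 ≤ (1 - p) ^ s := pow_nonneg (by linarith) _
  set bad : τ → ι → (ι → Bool) → ℝ := fun t i x =>
    if s < #{j | M t j = true} then
      (if ∀ j ∈ ({j | M t j = true} : Finset ι).erase i, x j = false then 1 else 0) else 0
    with hbad
  have hbad0 : ∀ t i x, 0 ≤ bad t i x := fun t i x => by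
    simp only [hbad]; split_ifs <;> norm_num
  calc _ ≤ ∑ x, bernoulliWeight p x * ∑ t, ∑ i, bad t i x := by
        refine sum_le_sum fun x _ => mul_le_mul_of_nonneg_left ?_ (hw x)
        split_ifs with h
        · exact sum_nonneg fun t _ => sum_nonneg fun i _ => hbad0 t i x
        · unfold LargeTestsSaturated at h
          push Not at h
          obtain ⟨t, ht, i, hi⟩ := h
          have hi' : ∀ j ∈ ({j | M t j = true} : Finset ι).erase i, x j = false := fun j hj => by
            by_contra hx
            exact hi j hj (by simpa using hx)
          calc (1 : ℝ) = bad t i x := by simp only [hbad, if_pos ht, if_pos hi']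
            _ ≤ ∑ i, bad t i x :=
                single_le_sum (f := fun i => bad t i x) (fun i _ => hbad0 t i x) (mem_univ i)
            _ ≤ ∑ t, ∑ i, bad t i x :=
                single_le_sum (f := fun t => ∑ i, bad t i x)
                  (fun t _ => sum_nonneg fun i _ => hbad0 t i x) (mem_univ t)
    _ = ∑ t, ∑ i, ∑ x, bernoulliWeight p x * bad t i x := by
        simp only [mul_sum]
        rw [sum_comm]
        exact sum_congr rfl fun t _ => sum_comm
    _ ≤ ∑ _t : τ, ∑ _i : ι, (1 - p) ^ s := by
        refine sum_le_sum fun t _ => sum_le_sum fun i _ => ?_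
        by_cases ht : s < #{j | M t j = true}
        · simp only [hbad, if_pos ht, sum_bernoulliWeight_forall_false]
          refine pow_le_pow_of_le_one (by linarith) (by linarith) ?_
          have := pred_card_le_card_erase (s := ({j | M t j = true} : Finset ι)) (a := i)
          omega
        · simpa [hbad, if_neg ht] using hq
    _ = _ := by simp; ring

omit [DecidableEq τ] in
lemma IsLocallyMasked.isMasked {M : τ → ι → Bool} {s : ℕ} {i : ι} {x : ι → Bool}
    (h : IsLocallyMasked M s i x) (hx : LargeTestsSaturated M s x) : IsMasked M i x := by
  intro t ht
  rcases le_or_gt #{j | M t j = true} s with hts | hts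
  · obtain ⟨j, hj, hxj⟩ := h t (mem_filter.2 ⟨mem_univ _, ht, hts⟩)
    exact ⟨j, ne_of_mem_erase hj, (mem_filter.1 (mem_of_mem_erase hj)).2, hxj⟩
  · obtain ⟨j, hj, hxj⟩ := hx t hts i
    exact ⟨j, ne_of_mem_erase hj, (mem_filter.1 (mem_of_mem_erase hj)).2, hxj⟩

end

/-- Nonasymptotic upper bound on the success probability. -/
lemma iidSuccProb_le {T n : ℕ} (M : Fin T → Fin n → Bool) (f : (Fin T → Bool) → (Fin n → Bool))
    {p a g : ℝ} {s : ℕ} (hp : 0 < p) (hp1 : p ≤ 1 / 2) (ha : 0 < a) (hs : 0 < s) (hg : 0 < g)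
    (hgn : g ≤ n - T - T / s - T * (Real.log 2 ^ 2 / p + Real.log (1 / p)) / a) :
    iidSuccProb M f p ≤ T * n * (1 - p) ^ s + 4 * s ^ 6 / (g * Real.exp (-a)) +
      2 / (p * (g * Real.exp (-a))) := by
  classical
  set m : ℝ := g * Real.exp (-a) with hm
  have hm0 : 0 < m := mul_pos hg (Real.exp_pos _)
  set G : Finset (Fin n) :=
    {i ∈ candidates M s | ∑ t ∈ smallTests M s i, maskCost p #(lightRow M s t) ≤ a} with hG
  have hGcard : g ≤ #G := by
    have := card_cheap_ge M s hp (by linarith) ha hs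
    simp only [Fintype.card_fin] at this
    exact hgn.trans this
  have hw : ∀ x : Fin n → Bool, 0 ≤ bernoulliWeight p x :=
    bernoulliWeight_nonneg hp.le (by linarith)
  have htail := lower_tail_of_few_dependencies (bernoulliWeight (ι := Fin n) p) hw
    (sum_bernoulliWeight p) (IsLocallyMasked M s) G (Dependent M s) (s ^ 6 : ℕ) m hm0
    (fun i hi => Nat.cast_le.2
      (card_dependent_le M s (candidates_subset_lightItems M s (mem_filter.1 hi).1) G))
    (fun i _ j _ hij => uncorrelated_of_not_dependent M s p hij)
    (by
      calc m ≤ #G * Real.exp (-a) := mul_le_mul_of_nonneg_right hGcard (Real.exp_pos _).le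
        _ = ∑ _i ∈ G, Real.exp (-a) := by rw [sum_const, nsmul_eq_mul]
        _ ≤ _ := sum_le_sum fun i hi =>
          (Real.exp_le_exp.2 (neg_le_neg (mem_filter.1 hi).2)).trans
            (exp_neg_cost_le_prob M s hp (by linarith) (mem_filter.1 hi).1))
  have hlarge := prob_not_largeTestsSaturated_le M s hp.le (by linarith : p ≤ 1)
  have hmask := iidSuccProb_le_of_masked M f hp hp1 (half_pos hm0)
  have hsplit : ∑ x, bernoulliWeight p x *
        (if (#{i | IsMasked M i x} : ℝ) < m / 2 then (1 : ℝ) else 0) ≤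
      ∑ x, bernoulliWeight p x * (if ¬ LargeTestsSaturated M s x then (1 : ℝ) else 0) +
        ∑ x, bernoulliWeight p x *
          (if (#{i ∈ G | IsLocallyMasked M s i x} : ℝ) < m / 2 then (1 : ℝ) else 0) := by
    rw [← sum_add_distrib]
    refine sum_le_sum fun x _ => ?_
    rw [← mul_add]
    refine mul_le_mul_of_nonneg_left ?_ (hw x)
    by_cases hx : LargeTestsSaturated M s x
    · have hle : (#{i ∈ G | IsLocallyMasked M s i x} : ℝ) ≤ #{i | IsMasked M i x} :=
        Nat.cast_le.2 (card_le_card fun i hi =>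
          mem_filter.2 ⟨mem_univ _, (mem_filter.1 hi).2.isMasked hx⟩)
      split_ifs <;> first | (exfalso; linarith) | norm_num
    · rw [if_pos hx]
      split_ifs <;> norm_num
  have h2 : 1 / (p * (m / 2)) = 2 / (p * m) := by field_simp
  simp only [Fintype.card_fin] at hlarge
  push_cast at htail
  rw [h2] at hmask
  linarith

lemma tendsto_pow_mul_exp_neg_mul (k : ℕ) {b : ℝ} (hb : 0 < b) :
    Tendsto (fun l : ℝ => l ^ k * Real.exp (-b * l)) atTop (nhds 0) := by
  simpa only [Real.rpow_natCast] using tendsto_rpow_mul_exp_neg_mul_atTop_nhds_zero (k : ℝ) b hb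

lemma tendsto_log_div_const_div {lam : ℝ} (hlam : 0 < lam) :
    Tendsto (fun l : ℝ => Real.log (l / lam) / l) atTop (nhds 0) := by
  have h1 : Tendsto (fun l : ℝ => Real.log l / l) atTop (nhds 0) :=
    Real.isLittleO_log_id_atTop.tendsto_div_nhds_zero
  have h2 : Tendsto (fun l : ℝ => Real.log lam / l) atTop (nhds 0) :=
    tendsto_const_nhds.div_atTop tendsto_id
  have h := h1.sub h2
  rw [sub_zero] at h
  refine h.congr' ?_
  filter_upwards [eventually_gt_atTop 0] with l hl
  rw [Real.log_div hl.ne' hlam.ne', sub_div]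

/-- The number of items that are cheap to mask is linear in `N` below the threshold. -/
lemma linear_gap {lam ε δ N t r L l B : ℝ} (hlam : 0 < lam) (hε : 0 < ε) (hε1 : ε ≤ 1)
    (hδ : δ = ε / 4) (ht : 0 ≤ t) (hL : 0 ≤ L) (hl : 0 < l)
    (htN : t ≤ (1 - ε) * (lam / (lam + L)) * N) (hN : 0 ≤ N) (hr : t / r ≤ ε / 16 * N)
    (hB : B / l ≤ ε / 16) :
    ε / 2 * N ≤ N - t - t / r - t * (L / (lam / l) + B) / ((1 - δ) * l) := by
  have hδ1 : 0 < 1 - δ := by linarith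
  have hlL : 0 < lam + L := by linarith
  have h1 : t * (1 + L / lam) ≤ (1 - ε) * N := by
    have h := mul_le_mul_of_nonneg_right htN (by positivity : 0 ≤ 1 + L / lam)
    refine h.trans (le_of_eq ?_)
    field_simp
  have htN' : t ≤ N := by
    have : 0 ≤ t * (L / lam) := by positivity
    nlinarith
  have h2 : t * (L / (lam / l) + B) / ((1 - δ) * l) = (t * (L / lam) + t * (B / l)) / (1 - δ) := by
    field_simp
  have h3 : t * (B / l) ≤ ε / 16 * N :=
    (mul_le_mul_of_nonneg_left hB ht).trans (by nlinarith)
  have h4 : (t * (L / lam) + t * (B / l)) / (1 - δ) ≤ N * (1 - 9 / 16 * ε) - t := by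
    rw [div_le_iff₀ hδ1, hδ]
    nlinarith [mul_nonneg ht hε.le, mul_nonneg hN hε.le,
      mul_nonneg (mul_nonneg hN hε.le) hε.le]
  rw [h2]
  linarith

lemma one_sub_pow_le_exp {p : ℝ} (hp1 : p ≤ 1) (s : ℕ) : (1 - p) ^ s ≤ Real.exp (-(p * s)) := by
  have h := pow_le_pow_left₀ (by linarith) (Real.one_sub_le_exp_neg p) s
  rwa [← Real.exp_nat_mul, mul_neg, mul_comm] at h

/-- Lower bound: with defective probability `p = λ/log n`, any sequence of test designs
using at most `(1−ε)·(λ/(λ+(log 2)²))·n` tests, with any decoders, has success probability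
tending to `0` (error probability `1 − o(1)`). -/
theorem success_tendsto_zero_below_linear_threshold (lam ε : ℝ) (hlam : 0 < lam) (hε : 0 < ε)
    (T : ℕ → ℕ) (M : ∀ n, Fin (T n) → Fin n → Bool)
    (f : ∀ n, (Fin (T n) → Bool) → (Fin n → Bool))
    (hT : ∀ n, (T n : ℝ) ≤ (1 - ε) * (lam / (lam + (Real.log 2) ^ 2)) * n) :
    Tendsto (fun n => iidSuccProb (M n) (f n) (lam / Real.log n)) atTop (nhds 0) := by
  have hε1 : ε ≤ 1 := by
    by_contra! h
    have hc : 0 < lam / (lam + Real.log 2 ^ 2) := by positivity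
    have h1 := hT 1
    have h2 : (1 - ε) * (lam / (lam + Real.log 2 ^ 2)) < 0 := mul_neg_of_neg_of_pos (by linarith) hc
    have h3 : (0 : ℝ) ≤ T 1 := Nat.cast_nonneg _
    push_cast at h1
    linarith
  set δ : ℝ := ε / 4 with hδ
  set γ : ℝ := δ / 10 with hγ
  have hδ0 : 0 < δ := by positivity
  have hγ0 : 0 < γ := by positivity
  have hlog : Tendsto (fun n : ℕ => Real.log n) atTop atTop :=
    Real.tendsto_log_atTop.comp tendsto_natCast_atTop_atTop
  have hbound : Tendsto (fun l : ℝ => l ^ 0 * Real.exp (-1 * l) +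
      512 / ε * (l ^ 0 * Real.exp (-(4 * γ) * l)) +
        4 / (lam * ε) * (l ^ 1 * Real.exp (-δ * l))) atTop (nhds 0) := by
    simpa using ((tendsto_pow_mul_exp_neg_mul 0 one_pos).add
      ((tendsto_pow_mul_exp_neg_mul 0 (by positivity : 0 < 4 * γ)).const_mul (512 / ε))).add
      ((tendsto_pow_mul_exp_neg_mul 1 hδ0).const_mul (4 / (lam * ε)))
  have hev : ∀ᶠ l : ℝ in atTop, 0 < l ∧ 2 * lam ≤ l ∧ Real.exp (-γ * l) ≤ ε / 16 ∧
      l ^ 2 * Real.exp (-γ * l) ≤ lam / 3 ∧ Real.log (l / lam) / l ≤ ε / 16 := by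
    have h1 := (tendsto_pow_mul_exp_neg_mul 0 hγ0).eventually_le_const
      (by positivity : 0 < ε / 16)
    simp only [pow_zero, one_mul] at h1
    filter_upwards [eventually_gt_atTop 0, eventually_ge_atTop (2 * lam), h1,
      (tendsto_pow_mul_exp_neg_mul 2 hγ0).eventually_le_const (by positivity : 0 < lam / 3),
      (tendsto_log_div_const_div hlam).eventually_le_const (by positivity : 0 < ε / 16)]
      with l h1 h2 h3 h4 h5 using ⟨h1, h2, h3, h4, h5⟩
  refine squeeze_zero' ?_ ?_ (hbound.comp hlog)
  · filter_upwards [hlog.eventually hev] with n hn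
    have hp : 0 ≤ lam / Real.log n := div_nonneg hlam.le hn.1.le
    have hp1 : lam / Real.log n ≤ 1 := by rw [div_le_one hn.1]; linarith [hn.2.1]
    exact sum_nonneg fun x _ => mul_nonneg (bernoulliWeight_nonneg hp hp1 x)
      (by split_ifs <;> norm_num)
  filter_upwards [hlog.eventually hev, eventually_gt_atTop 0] with n hn hn0
  have hN : (0 : ℝ) < n := Nat.cast_pos.2 hn0
  have hexpl : Real.exp (Real.log n) = n := Real.exp_log hN
  simp only [Function.comp]
  set l : ℝ := Real.log n with hl
  obtain ⟨hl0, hl2, hl3, hl4, hl5⟩ := hn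
  set s : ℕ := ⌈Real.exp (γ * l)⌉₊ with hs
  have hE : 1 ≤ Real.exp (γ * l) := Real.one_le_exp (by positivity)
  have hsE : Real.exp (γ * l) ≤ s := Nat.le_ceil _
  have hsE2 : (s : ℝ) ≤ 2 * Real.exp (γ * l) := by
    have := (Nat.ceil_lt_add_one (Real.exp_pos (γ * l)).le).le
    linarith
  have hs0 : (0 : ℝ) < s := by linarith
  have hinv : Real.exp (-γ * l) = (Real.exp (γ * l))⁻¹ := by rw [neg_mul, Real.exp_neg]
  have hTn : (T n : ℝ) ≤ n := by
    have hc : lam / (lam + Real.log 2 ^ 2) ≤ 1 := by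
      rw [div_le_one (by positivity)]
      linarith [sq_nonneg (Real.log 2)]
    refine (hT n).trans (mul_le_of_le_one_left hN.le ?_)
    exact mul_le_one₀ (by linarith) (by positivity) hc
  have hTs : (T n : ℝ) / s ≤ ε / 16 * n := by
    calc (T n : ℝ) / s ≤ n / Real.exp (γ * l) :=
          div_le_div₀ hN.le hTn (Real.exp_pos _) hsE
      _ = Real.exp (-γ * l) * n := by rw [hinv, div_eq_inv_mul]
      _ ≤ ε / 16 * n := mul_le_mul_of_nonneg_right hl3 hN.le
  have hgap := linear_gap hlam hε hε1 hδ (Nat.cast_nonneg (T n)) (sq_nonneg (Real.log 2)) hl0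
    (hT n) hN.le hTs hl5
  have hp0 : 0 < lam / l := by positivity
  have hp1 : lam / l ≤ 1 / 2 := by rw [div_le_iff₀ hl0]; linarith
  have hmain := iidSuccProb_le (M n) (f n) (p := lam / l) (a := (1 - δ) * l) (g := ε / 2 * n)
    (s := s) hp0 hp1 (mul_pos (by linarith) hl0) (by exact_mod_cast hs0) (by positivity)
    (by rw [one_div_div]; exact hgap)
  have hm : ε / 2 * n * Real.exp (-((1 - δ) * l)) = ε / 2 * Real.exp (δ * l) := by
    rw [mul_assoc, ← hexpl, ← Real.exp_add]
    ring_nf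
  rw [hm] at hmain
  have hps : 3 * l ≤ lam / l * s := by
    have h : 3 * l ^ 2 ≤ lam * Real.exp (γ * l) := by
      rw [hinv, ← div_eq_mul_inv, div_le_iff₀ (Real.exp_pos _)] at hl4
      linarith
    rw [div_mul_eq_mul_div, le_div_iff₀ hl0]
    nlinarith
  have ht1 : (T n : ℝ) * n * (1 - lam / l) ^ s ≤ l ^ 0 * Real.exp (-1 * l) := by
    calc (T n : ℝ) * n * (1 - lam / l) ^ s ≤ n * n * Real.exp (-(3 * l)) := by
          refine mul_le_mul (mul_le_mul_of_nonneg_right hTn hN.le)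
            ((one_sub_pow_le_exp (by linarith) s).trans (Real.exp_le_exp.2 (neg_le_neg hps)))
            (pow_nonneg (by linarith) _) (by positivity)
      _ = l ^ 0 * Real.exp (-1 * l) := by
          rw [← hexpl, ← Real.exp_add, ← Real.exp_add, pow_zero, one_mul]
          ring_nf
  have ht2 : 4 * (s : ℝ) ^ 6 / (ε / 2 * Real.exp (δ * l)) ≤
      512 / ε * (l ^ 0 * Real.exp (-(4 * γ) * l)) := by
    have h6 : (s : ℝ) ^ 6 ≤ 64 * Real.exp (6 * (γ * l)) := by
      refine (pow_le_pow_left₀ hs0.le hsE2 6).trans (le_of_eq ?_)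
      rw [mul_pow, ← Real.exp_nat_mul]
      norm_num
    have hexp : Real.exp (6 * (γ * l)) = Real.exp (-(4 * γ) * l) * Real.exp (δ * l) := by
      rw [← Real.exp_add, hγ]
      ring_nf
    rw [div_le_iff₀ (by positivity), pow_zero, one_mul]
    calc 4 * (s : ℝ) ^ 6 ≤ 4 * (64 * Real.exp (6 * (γ * l))) := by linarith
      _ = _ := by rw [hexp]; field_simp; ring
  have ht3 : 2 / (lam / l * (ε / 2 * Real.exp (δ * l))) =
      4 / (lam * ε) * (l ^ 1 * Real.exp (-δ * l)) := by
    rw [neg_mul, Real.exp_neg]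
    field_simp
    ring
  rw [ht3] at hmain
  linarith
end
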